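/- Define the Chern–Finsler connection coefficients L^γ_{αβ} := h^{σ̄γ}·δ_β h_{ασ̄} on U × (ℂᵐ \ {0}), where δ_β g := ρ^k_β·δ_k g, and correspondingly L̃^τ_{αβ} from F̃ on Ũ × (ℂᵐ \ {0}). Then for every (z,u) ∈ U × (ℂᵐ \ {0}) and all 1 ≤ α, β, τ ≤ m: L̃^τ_{αβ}(φ(z), M(z)u) = M^τ_γ(z)·W^σ_β(z)·[ρ^k_σ(z)·(∂W^γ_α/∂z^k)(z) + W^θ_α(z)·L^γ_{θσ}(z,u)]. (This is the theorem that the functions L^γ_{αβ} = h^{σ̄γ}δ_β h_{ασ̄} are the coefficients of a linear connection of (1,0)-type on the complexified prolongation, the Chern–Finsler connection of the algebroid.) -/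

import Mathlib

open Complex BigOperators

/-- Wirtinger derivative `∂_k g` in the base direction, for `g : ℂⁿ × ℂᵐ → ℂ`,
defined through the real Fréchet derivative. -/
noncomputable def wz {n m : ℕ} (g : (Fin n → ℂ) × (Fin m → ℂ) → ℂ) (k : Fin n)
    (p : (Fin n → ℂ) × (Fin m → ℂ)) : ℂ :=
  (1/2) * (fderiv ℝ g p (Pi.single k 1, 0)
    - Complex.I * fderiv ℝ g p (Pi.single k Complex.I, 0))

/-- Wirtinger derivative `∂̇_α g` in the fibre direction. -/
noncomputable def wu {n m : ℕ} (g : (Fin n → ℂ) × (Fin m → ℂ) → ℂ) (α : Fin m)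
    (p : (Fin n → ℂ) × (Fin m → ℂ)) : ℂ :=
  (1/2) * (fderiv ℝ g p (0, Pi.single α 1)
    - Complex.I * fderiv ℝ g p (0, Pi.single α Complex.I))

/-- Conjugate Wirtinger derivative `∂̇_ᾱ g` in the fibre direction. -/
noncomputable def wubar {n m : ℕ} (g : (Fin n → ℂ) × (Fin m → ℂ) → ℂ) (α : Fin m)
    (p : (Fin n → ℂ) × (Fin m → ℂ)) : ℂ :=
  (1/2) * (fderiv ℝ g p (0, Pi.single α 1)
    + Complex.I * fderiv ℝ g p (0, Pi.single α Complex.I))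

/-- The Levi metric tensor `h_{αβ̄} = ∂̇_α ∂̇_β̄ F` of a Finsler function `F`. -/
noncomputable def hmet {n m : ℕ} (F : (Fin n → ℂ) × (Fin m → ℂ) → ℝ) (α β : Fin m)
    (p : (Fin n → ℂ) × (Fin m → ℂ)) : ℂ :=
  wu (wubar (fun q => (F q : ℂ)) β) α p

/-- The Chern–Finsler nonlinear connection coefficients `N^β_k = h^{σ̄β}·∂_k ∂̇_σ̄ F`,
where `hinv σ β = h^{σ̄β}` are the entries of the inverse of `(h_{ασ̄})`. -/
noncomputable def Ncf {n m : ℕ} (F : (Fin n → ℂ) × (Fin m → ℂ) → ℝ)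
    (hinv : Fin m → Fin m → (Fin n → ℂ) × (Fin m → ℂ) → ℂ) (β : Fin m) (k : Fin n)
    (p : (Fin n → ℂ) × (Fin m → ℂ)) : ℂ :=
  ∑ σ, hinv σ β p * wz (wubar (fun q => (F q : ℂ)) σ) k p

/-- The horizontal derivative `δ_k g = ∂_k g − N^β_k·∂̇_β g`. -/
noncomputable def deltak {n m : ℕ} (F : (Fin n → ℂ) × (Fin m → ℂ) → ℝ)
    (hinv : Fin m → Fin m → (Fin n → ℂ) × (Fin m → ℂ) → ℂ)
    (g : (Fin n → ℂ) × (Fin m → ℂ) → ℂ) (k : Fin n)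
    (p : (Fin n → ℂ) × (Fin m → ℂ)) : ℂ :=
  wz g k p - ∑ β, Ncf F hinv β k p * wu g β p

/-- The anchored nonlinear connection coefficients `N^γ_β = ρ^k_β·N^γ_k`. -/
noncomputable def Nanch {n m : ℕ} (F : (Fin n → ℂ) × (Fin m → ℂ) → ℝ)
    (hinv : Fin m → Fin m → (Fin n → ℂ) × (Fin m → ℂ) → ℂ)
    (ρ : Fin n → Fin m → (Fin n → ℂ) → ℂ) (γ β : Fin m)
    (p : (Fin n → ℂ) × (Fin m → ℂ)) : ℂ :=
  ∑ k, ρ k β p.1 * Ncf F hinv γ k p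

/-- The anchored horizontal derivative `δ_β g = ρ^k_β·δ_k g`. -/
noncomputable def delanch {n m : ℕ} (F : (Fin n → ℂ) × (Fin m → ℂ) → ℝ)
    (hinv : Fin m → Fin m → (Fin n → ℂ) × (Fin m → ℂ) → ℂ)
    (ρ : Fin n → Fin m → (Fin n → ℂ) → ℂ)
    (g : (Fin n → ℂ) × (Fin m → ℂ) → ℂ) (β : Fin m)
    (p : (Fin n → ℂ) × (Fin m → ℂ)) : ℂ :=
  ∑ k, ρ k β p.1 * deltak F hinv g k p

/-- Wirtinger derivative `∂_h g` for a function of the base variable only. -/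
noncomputable def wz1 {n : ℕ} (g : (Fin n → ℂ) → ℂ) (h : Fin n) (z : Fin n → ℂ) : ℂ :=
  (1/2) * (fderiv ℝ g z (Pi.single h 1)
    - Complex.I * fderiv ℝ g z (Pi.single h Complex.I))

/-- The Chern–Finsler connection coefficients `L^γ_{αβ} = h^{σ̄γ}·δ_β h_{ασ̄}`,
where `δ_β g = ρ^k_β·δ_k g`. -/
noncomputable def Lcf {n m : ℕ} (F : (Fin n → ℂ) × (Fin m → ℂ) → ℝ)
    (hinv : Fin m → Fin m → (Fin n → ℂ) × (Fin m → ℂ) → ℂ)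
    (ρ : Fin n → Fin m → (Fin n → ℂ) → ℂ) (γ α β : Fin m)
    (p : (Fin n → ℂ) × (Fin m → ℂ)) : ℂ :=
  ∑ σ, hinv σ γ p * delanch F hinv ρ (hmet F α σ) β p

open scoped Matrix in
/-- Conjugating both factors of the relation `h * k = 1` by a change of frame. -/
theorem inverse_of_change_of_frame {m : ℕ} {A Ab h ht k kt : Matrix (Fin m) (Fin m) ℂ}
    (hh : h = Aᵀ * ht * Ab) (hk : h * k = 1) (hkt : ht * kt = 1) :
    Ab * k * Aᵀ = kt := by
  have h1 : Aᵀ * (ht * Ab * k) = 1 := by rw [← hk, hh]; simp only [Matrix.mul_assoc]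
  have h2 : ht * (Ab * k * Aᵀ) = 1 := by
    rw [← mul_eq_one_comm.mp h1]; simp only [Matrix.mul_assoc]
  have h3 : kt * ht = 1 := mul_eq_one_comm.mp hkt
  calc Ab * k * Aᵀ = kt * ht * (Ab * k * Aᵀ) := by rw [h3, one_mul]
    _ = kt := by rw [Matrix.mul_assoc, h2, mul_one]

section Wirtinger

variable {E G : Type*} [NormedAddCommGroup E] [NormedSpace ℂ E]
  [NormedAddCommGroup G] [NormedSpace ℂ G]

theorem map_complex_smul (L : E →L[ℝ] ℂ) (c : ℂ) (v : E) :
    L (c • v) = c.re * L v + c.im * L (I • v) := by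
  have h : c • v = c.re • v + c.im • (I • v) := by
    conv_lhs => rw [← Complex.re_add_im c]
    rw [add_smul, mul_smul]
    rfl
  rw [h, map_add, map_smul, map_smul, Complex.real_smul, Complex.real_smul]

/-- The complex-linear part of the real derivative of `g` at `x`. -/
noncomputable def holoDeriv (g : E → ℂ) (x : E) : E →ₗ[ℂ] ℂ where
  toFun v := (1/2) * (fderiv ℝ g x v - I * fderiv ℝ g x (I • v))
  map_add' v w := by simp only [smul_add, map_add]; ring
  map_smul' c v := by
    rw [map_complex_smul _ c v, smul_comm I c v, map_complex_smul _ c (I • v), smul_smul, I_mul_I,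
      neg_one_smul, map_neg, RingHom.id_apply, smul_eq_mul]
    conv_rhs => rw [← Complex.re_add_im c]
    linear_combination ((1/2) * c.im * fderiv ℝ g x (I • v)) * I_sq

/-- The conjugate-linear part of the real derivative of `g` at `x`. -/
noncomputable def antiholoDeriv (g : E → ℂ) (x : E) : E →ₛₗ[starRingEnd ℂ] ℂ where
  toFun v := (1/2) * (fderiv ℝ g x v + I * fderiv ℝ g x (I • v))
  map_add' v w := by simp only [smul_add, map_add]; ring
  map_smul' c v := by
    have hc : (starRingEnd ℂ) c = c.re - c.im * I := by
      apply Complex.ext <;> simp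
    rw [map_complex_smul _ c v, smul_comm I c v, map_complex_smul _ c (I • v), smul_smul, I_mul_I,
      neg_one_smul, map_neg, smul_eq_mul, hc]
    linear_combination ((1/2) * c.im * fderiv ℝ g x (I • v)) * I_sq

theorem holoDeriv_apply (g : E → ℂ) (x v : E) :
    holoDeriv g x v = (1/2) * (fderiv ℝ g x v - I * fderiv ℝ g x (I • v)) := rfl

theorem antiholoDeriv_apply (g : E → ℂ) (x v : E) :
    antiholoDeriv g x v = (1/2) * (fderiv ℝ g x v + I * fderiv ℝ g x (I • v)) := rfl

theorem holoDeriv_congr {f g : E → ℂ} {x : E} (h : f =ᶠ[nhds x] g) :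
    holoDeriv f x = holoDeriv g x := by
  ext v; simp only [holoDeriv_apply, h.fderiv_eq]

theorem antiholoDeriv_congr {f g : E → ℂ} {x : E} (h : f =ᶠ[nhds x] g) :
    antiholoDeriv f x = antiholoDeriv g x := by
  ext v; simp only [antiholoDeriv_apply, h.fderiv_eq]

theorem fderiv_real_comp {g : G → ℂ} {f : E → G} {x : E} (hg : DifferentiableAt ℝ g (f x))
    (hf : DifferentiableAt ℂ f x) (v : E) :
    fderiv ℝ (fun y => g (f y)) x v = fderiv ℝ g (f x) (fderiv ℂ f x v) := by
  have h : HasFDerivAt (fun y => g (f y)) _ x :=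
    hg.hasFDerivAt.comp x (hf.hasFDerivAt.restrictScalars ℝ)
  rw [h.fderiv]
  rfl

theorem holoDeriv_comp {g : G → ℂ} {f : E → G} {x : E} (hg : DifferentiableAt ℝ g (f x))
    (hf : DifferentiableAt ℂ f x) (v : E) :
    holoDeriv (fun y => g (f y)) x v = holoDeriv g (f x) (fderiv ℂ f x v) := by
  simp only [holoDeriv_apply, fderiv_real_comp hg hf, map_smul]

theorem antiholoDeriv_comp {g : G → ℂ} {f : E → G} {x : E} (hg : DifferentiableAt ℝ g (f x))
    (hf : DifferentiableAt ℂ f x) (v : E) :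
    antiholoDeriv (fun y => g (f y)) x v = antiholoDeriv g (f x) (fderiv ℂ f x v) := by
  simp only [antiholoDeriv_apply, fderiv_real_comp hg hf, map_smul]

theorem holoDeriv_of_differentiableAt {f : E → ℂ} {x : E} (hf : DifferentiableAt ℂ f x) (v : E) :
    holoDeriv f x v = fderiv ℂ f x v := by
  rw [holoDeriv_apply, (hf.hasFDerivAt.restrictScalars ℝ).fderiv]
  simp only [ContinuousLinearMap.coe_restrictScalars', map_smul, smul_eq_mul]
  linear_combination (-(1/2) * fderiv ℂ f x v) * I_sq

theorem holoDeriv_conj {f : E → ℂ} {x : E} (hf : DifferentiableAt ℂ f x) (v : E) :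
    holoDeriv (fun y => (starRingEnd ℂ) (f y)) x v = 0 := by
  have h : HasFDerivAt (fun y => (starRingEnd ℂ) (f y))
      ((conjCLE : ℂ →L[ℝ] ℂ).comp ((fderiv ℂ f x).restrictScalars ℝ)) x :=
    (conjCLE : ℂ →L[ℝ] ℂ).hasFDerivAt.comp x (hf.hasFDerivAt.restrictScalars ℝ)
  rw [holoDeriv_apply, h.fderiv]
  simp
  linear_combination ((starRingEnd ℂ) (fderiv ℂ f x v)) * I_sq

theorem holoDeriv_mul {f g : E → ℂ} {x : E} (hf : DifferentiableAt ℝ f x)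
    (hg : DifferentiableAt ℝ g x) (v : E) :
    holoDeriv (fun y => f y * g y) x v = holoDeriv f x v * g x + f x * holoDeriv g x v := by
  simp only [holoDeriv_apply, fderiv_fun_mul hf hg, add_apply,
    smul_apply, smul_eq_mul]
  ring

theorem holoDeriv_sum {ι : Type*} (s : Finset ι) {f : ι → E → ℂ} {x : E}
    (hf : ∀ i ∈ s, DifferentiableAt ℝ (f i) x) (v : E) :
    holoDeriv (fun y => ∑ i ∈ s, f i y) x v = ∑ i ∈ s, holoDeriv (f i) x v := by
  simp only [holoDeriv_apply, fderiv_fun_sum hf, sum_apply,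
    Finset.mul_sum, ← Finset.sum_sub_distrib]

end Wirtinger

section Coordinates

variable {n m : ℕ}

theorem I_smul_single {k : ℕ} (i : Fin k) :
    I • (Pi.single i 1 : Fin k → ℂ) = Pi.single i I := by
  rw [← Pi.single_smul, smul_eq_mul, mul_one]

theorem wz_eq (g : (Fin n → ℂ) × (Fin m → ℂ) → ℂ) (k : Fin n) (p) :
    wz g k p = holoDeriv g p (Pi.single k 1, 0) := by
  rw [wz, holoDeriv_apply, Prod.smul_mk, I_smul_single, smul_zero]

theorem wu_eq (g : (Fin n → ℂ) × (Fin m → ℂ) → ℂ) (α : Fin m) (p) :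
    wu g α p = holoDeriv g p (0, Pi.single α 1) := by
  rw [wu, holoDeriv_apply, Prod.smul_mk, I_smul_single, smul_zero]

theorem wubar_eq (g : (Fin n → ℂ) × (Fin m → ℂ) → ℂ) (α : Fin m) (p) :
    wubar g α p = antiholoDeriv g p (0, Pi.single α 1) := by
  rw [wubar, antiholoDeriv_apply, Prod.smul_mk, I_smul_single, smul_zero]

theorem wz1_eq (g : (Fin n → ℂ) → ℂ) (k : Fin n) (z) :
    wz1 g k z = holoDeriv g z (Pi.single k 1) := by
  rw [wz1, holoDeriv_apply, I_smul_single]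

theorem prod_eq_sum (x : Fin n → ℂ) (y : Fin m → ℂ) :
    (x, y) = (∑ j, x j • ((Pi.single j 1, 0) : (Fin n → ℂ) × (Fin m → ℂ)))
      + ∑ ν, y ν • ((0, Pi.single ν 1) : (Fin n → ℂ) × (Fin m → ℂ)) := by
  ext i <;> simp [Prod.fst_sum, Prod.snd_sum, Finset.sum_apply, Pi.single_apply]

theorem holoDeriv_prod (g : (Fin n → ℂ) × (Fin m → ℂ) → ℂ) (p) (x : Fin n → ℂ) (y : Fin m → ℂ) :
    holoDeriv g p (x, y) = ∑ j, x j * wz g j p + ∑ ν, y ν * wu g ν p := by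
  rw [prod_eq_sum x y, map_add, map_sum, map_sum]
  simp only [map_smul, wz_eq, wu_eq, smul_eq_mul]

theorem antiholoDeriv_vertical (g : (Fin n → ℂ) × (Fin m → ℂ) → ℂ) (p) (y : Fin m → ℂ) :
    antiholoDeriv g p (0, y) = ∑ ν, (starRingEnd ℂ) (y ν) * wubar g ν p := by
  rw [prod_eq_sum 0 y, map_add, map_sum, map_sum]
  simp only [map_smulₛₗ, wubar_eq, smul_eq_mul, Pi.zero_apply, map_zero, zero_mul,
    Finset.sum_const_zero, zero_add]

theorem contDiffOn_wu {S : Set ((Fin n → ℂ) × (Fin m → ℂ))} (hS : IsOpen S)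
    {g : (Fin n → ℂ) × (Fin m → ℂ) → ℂ} (hg : ContDiffOn ℝ (⊤ : ℕ∞) g S) (α : Fin m) :
    ContDiffOn ℝ (⊤ : ℕ∞) (wu g α) S := by
  have h := hg.fderiv_of_isOpen (m := (⊤ : ℕ∞)) hS (by simp)
  exact contDiffOn_const.mul ((h.clm_apply contDiffOn_const).sub
    (contDiffOn_const.mul (h.clm_apply contDiffOn_const)))

theorem contDiffOn_wubar {S : Set ((Fin n → ℂ) × (Fin m → ℂ))} (hS : IsOpen S)
    {g : (Fin n → ℂ) × (Fin m → ℂ) → ℂ} (hg : ContDiffOn ℝ (⊤ : ℕ∞) g S) (α : Fin m) :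
    ContDiffOn ℝ (⊤ : ℕ∞) (wubar g α) S := by
  have h := hg.fderiv_of_isOpen (m := (⊤ : ℕ∞)) hS (by simp)
  exact contDiffOn_const.mul ((h.clm_apply contDiffOn_const).add
    (contDiffOn_const.mul (h.clm_apply contDiffOn_const)))

theorem isOpen_slit {U : Set (Fin n → ℂ)} (hU : IsOpen U) :
    IsOpen {p : (Fin n → ℂ) × (Fin m → ℂ) | p.1 ∈ U ∧ p.2 ≠ 0} :=
  (hU.preimage continuous_fst).inter (isOpen_ne.preimage continuous_snd)

/-- The horizontal lift of the `k`-th coordinate vector with fibre component `-N^β_k`. -/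
noncomputable def hlift (F : (Fin n → ℂ) × (Fin m → ℂ) → ℝ)
    (hinv : Fin m → Fin m → (Fin n → ℂ) × (Fin m → ℂ) → ℂ) (k : Fin n)
    (p : (Fin n → ℂ) × (Fin m → ℂ)) : (Fin n → ℂ) × (Fin m → ℂ) :=
  (Pi.single k 1, fun β => -Ncf F hinv β k p)

theorem deltak_eq (F : (Fin n → ℂ) × (Fin m → ℂ) → ℝ)
    (hinv : Fin m → Fin m → (Fin n → ℂ) × (Fin m → ℂ) → ℂ)
    (g : (Fin n → ℂ) × (Fin m → ℂ) → ℂ) (k : Fin n) (p) :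
    deltak F hinv g k p = holoDeriv g p (hlift F hinv k p) := by
  rw [hlift, holoDeriv_prod, deltak]
  simp [Pi.single_apply, sub_eq_add_neg]

/-- The map `(z, u) ↦ (φ z, M z u)` of total spaces. -/
noncomputable def bundleMap (φ : (Fin n → ℂ) → (Fin n → ℂ)) (M : (Fin n → ℂ) → Fin m → Fin m → ℂ)
    (p : (Fin n → ℂ) × (Fin m → ℂ)) : (Fin n → ℂ) × (Fin m → ℂ) :=
  (φ p.1, fun δ => ∑ β, M p.1 δ β * p.2 β)

theorem differentiableAt_and_fderiv_bundleMap {φ : (Fin n → ℂ) → (Fin n → ℂ)}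
    {M : (Fin n → ℂ) → Fin m → Fin m → ℂ} {p : (Fin n → ℂ) × (Fin m → ℂ)}
    (hφ : ∀ k, DifferentiableAt ℂ (fun z => φ z k) p.1)
    (hM : ∀ α β, DifferentiableAt ℂ (fun z => M z α β) p.1) :
    DifferentiableAt ℂ (bundleMap φ M) p ∧
    ∀ x y, fderiv ℂ (bundleMap φ M) p (x, y) =
      (fun j => fderiv ℂ (fun z => φ z j) p.1 x,
        fun ν => ∑ β, (fderiv ℂ (fun z => M z ν β) p.1 x * p.2 β + M p.1 ν β * y β)) := by
  have hfst : HasFDerivAt (fun q : (Fin n → ℂ) × (Fin m → ℂ) => q.1)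
      (ContinuousLinearMap.fst ℂ (Fin n → ℂ) (Fin m → ℂ)) p := hasFDerivAt_fst
  have h2 (β) : HasFDerivAt (fun q : (Fin n → ℂ) × (Fin m → ℂ) => q.2 β)
      ((ContinuousLinearMap.proj β).comp (ContinuousLinearMap.snd ℂ (Fin n → ℂ) (Fin m → ℂ))) p :=
    ((ContinuousLinearMap.proj (R := ℂ) (φ := fun _ : Fin m => ℂ) β).comp
      (ContinuousLinearMap.snd ℂ (Fin n → ℂ) (Fin m → ℂ))).hasFDerivAt
  have hA := hasFDerivAt_pi.mpr fun j => (hφ j).hasFDerivAt.comp p hfst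
  have hB := hasFDerivAt_pi.mpr fun ν => HasFDerivAt.fun_sum (u := Finset.univ)
    fun β _ => ((hM ν β).hasFDerivAt.comp p hfst).mul (h2 β)
  have h : HasFDerivAt (bundleMap φ M) _ p := hA.prodMk hB
  refine ⟨h.differentiableAt, fun x y => ?_⟩
  rw [h.fderiv]
  ext i
  · simp
  · simp [sum_apply, mul_comm, add_comm]

end Coordinates

theorem differentiableAt_det {E : Type*} [NormedAddCommGroup E] [NormedSpace ℂ E] {m : ℕ}
    {A : E → Matrix (Fin m) (Fin m) ℂ} {x : E}
    (hA : ∀ i j, DifferentiableAt ℂ (fun y => A y i j) x) :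
    DifferentiableAt ℂ (fun y => (A y).det) x := by
  simp only [Matrix.det_apply']
  exact DifferentiableAt.fun_sum fun σ _ =>
    ((HasFDerivAt.finsetProd fun i _ => (hA (σ i) i).hasFDerivAt).differentiableAt).const_mul _

section ChangeOfFrame

open scoped Matrix

variable {n m : ℕ}

/-- The set of points over `U` with nonzero fibre component. -/
def slit (m : ℕ) (U : Set (Fin n → ℂ)) : Set ((Fin n → ℂ) × (Fin m → ℂ)) :=
  {p | p.1 ∈ U ∧ p.2 ≠ 0}

/-- The functions `F` and `Ft` correspond to each other under the map `(z, u) ↦ (φ z, M z u)`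
with holomorphic `φ` and holomorphic invertible `M`. -/
structure FrameChange (U Ut : Set (Fin n → ℂ)) (φ : (Fin n → ℂ) → (Fin n → ℂ))
    (M W : (Fin n → ℂ) → Fin m → Fin m → ℂ) (F Ft : (Fin n → ℂ) × (Fin m → ℂ) → ℝ) : Prop where
  isOpen : IsOpen U
  isOpen_target : IsOpen Ut
  diff_base : ∀ k, DifferentiableOn ℂ (fun z => φ z k) U
  mapsTo : Set.MapsTo φ U Ut
  diff_frame : ∀ α β, DifferentiableOn ℂ (fun z => M z α β) U
  mul_inverse : ∀ z ∈ U, Matrix.of (M z) * Matrix.of (W z) = 1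
  smooth : ContDiffOn ℝ (⊤ : ℕ∞) Ft (slit m Ut)
  rel : ∀ p ∈ slit m U, Ft (bundleMap φ M p) = F p

namespace FrameChange

variable {U Ut : Set (Fin n → ℂ)} {φ : (Fin n → ℂ) → (Fin n → ℂ)}
  {M W : (Fin n → ℂ) → Fin m → Fin m → ℂ} {F Ft : (Fin n → ℂ) × (Fin m → ℂ) → ℝ}
  {p : (Fin n → ℂ) × (Fin m → ℂ)}

theorem diffAt_base (c : FrameChange U Ut φ M W F Ft) (hp : p ∈ slit m U) (k : Fin n) :
    DifferentiableAt ℂ (fun z => φ z k) p.1 :=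
  (c.diff_base k).differentiableAt (c.isOpen.mem_nhds hp.1)

theorem diffAt_frame (c : FrameChange U Ut φ M W F Ft) (hp : p ∈ slit m U) (α β : Fin m) :
    DifferentiableAt ℂ (fun z => M z α β) p.1 :=
  (c.diff_frame α β).differentiableAt (c.isOpen.mem_nhds hp.1)

theorem diffAt_frame_fst (c : FrameChange U Ut φ M W F Ft) (hp : p ∈ slit m U) (α β : Fin m) :
    DifferentiableAt ℂ (fun q : (Fin n → ℂ) × (Fin m → ℂ) => M q.1 α β) p :=
  (c.diffAt_frame hp α β).comp p differentiableAt_fst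

theorem diffAt_bundleMap (c : FrameChange U Ut φ M W F Ft) (hp : p ∈ slit m U) :
    DifferentiableAt ℂ (bundleMap φ M) p :=
  (differentiableAt_and_fderiv_bundleMap (c.diffAt_base hp) (c.diffAt_frame hp)).1

theorem fderiv_bundleMap (c : FrameChange U Ut φ M W F Ft) (hp : p ∈ slit m U) (x y) :
    fderiv ℂ (bundleMap φ M) p (x, y) =
      (fun j => fderiv ℂ (fun z => φ z j) p.1 x,
        fun ν => ∑ β, (fderiv ℂ (fun z => M z ν β) p.1 x * p.2 β + M p.1 ν β * y β)) :=
  (differentiableAt_and_fderiv_bundleMap (c.diffAt_base hp) (c.diffAt_frame hp)).2 x y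

theorem bundleMap_mem (c : FrameChange U Ut φ M W F Ft) (hp : p ∈ slit m U) :
    bundleMap φ M p ∈ slit m Ut := by
  refine ⟨c.mapsTo hp.1, fun h => hp.2 ?_⟩
  have h0 : Matrix.of (M p.1) *ᵥ p.2 = 0 := h
  rw [← Matrix.one_mulVec p.2, ← mul_eq_one_comm.mp (c.mul_inverse p.1 hp.1),
    ← Matrix.mulVec_mulVec, h0, Matrix.mulVec_zero]

theorem slit_mem_nhds (c : FrameChange U Ut φ M W F Ft) (hp : p ∈ slit m U) :
    slit m U ∈ nhds p :=
  (isOpen_slit c.isOpen).mem_nhds hp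

theorem contDiffOn_ofReal (c : FrameChange U Ut φ M W F Ft) :
    ContDiffOn ℝ (⊤ : ℕ∞) (fun q => (Ft q : ℂ)) (slit m Ut) :=
  ofRealCLM.contDiff.comp_contDiffOn c.smooth

theorem diffAt_of_contDiffOn (c : FrameChange U Ut φ M W F Ft) (hp : p ∈ slit m U)
    {G : (Fin n → ℂ) × (Fin m → ℂ) → ℂ} (hG : ContDiffOn ℝ (⊤ : ℕ∞) G (slit m Ut)) :
    DifferentiableAt ℝ G (bundleMap φ M p) :=
  (hG.differentiableOn (by simp)).differentiableAt
    ((isOpen_slit c.isOpen_target).mem_nhds (c.bundleMap_mem hp))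

theorem contDiffOn_wubar (c : FrameChange U Ut φ M W F Ft) (σ : Fin m) :
    ContDiffOn ℝ (⊤ : ℕ∞) (wubar (fun q => (Ft q : ℂ)) σ) (slit m Ut) :=
  _root_.contDiffOn_wubar (isOpen_slit c.isOpen_target) c.contDiffOn_ofReal σ

theorem contDiffOn_hmet (c : FrameChange U Ut φ M W F Ft) (α σ : Fin m) :
    ContDiffOn ℝ (⊤ : ℕ∞) (hmet Ft α σ) (slit m Ut) :=
  contDiffOn_wu (isOpen_slit c.isOpen_target) (c.contDiffOn_wubar σ) α

theorem wubar_eq (c : FrameChange U Ut φ M W F Ft) (hp : p ∈ slit m U) (σ : Fin m) :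
    wubar (fun q => (F q : ℂ)) σ p = ∑ ν, (starRingEnd ℂ) (M p.1 ν σ) *
      wubar (fun q => (Ft q : ℂ)) ν (bundleMap φ M p) := by
  have h : (fun q => (F q : ℂ)) =ᶠ[nhds p] fun q => (Ft (bundleMap φ M q) : ℂ) := by
    filter_upwards [c.slit_mem_nhds hp] with q hq
    rw [c.rel q hq]
  rw [_root_.wubar_eq, antiholoDeriv_congr h,
    antiholoDeriv_comp (c.diffAt_of_contDiffOn hp c.contDiffOn_ofReal) (c.diffAt_bundleMap hp),
    c.fderiv_bundleMap hp]
  simp only [map_zero, zero_mul, zero_add]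
  rw [show (fun _ : Fin n => (0 : ℂ)) = 0 from rfl, antiholoDeriv_vertical]
  simp [Pi.single_apply]

/-- Derivatives of a function of the form `∑ ν, conj (M ν σ) * G ν`. -/
theorem holoDeriv_sum_conj (c : FrameChange U Ut φ M W F Ft) (hp : p ∈ slit m U) (σ : Fin m)
    {H : (Fin n → ℂ) × (Fin m → ℂ) → ℂ} {G : Fin m → (Fin n → ℂ) × (Fin m → ℂ) → ℂ}
    (hH : ∀ q ∈ slit m U, H q = ∑ ν, (starRingEnd ℂ) (M q.1 ν σ) * G ν q)
    (hG : ∀ ν, DifferentiableAt ℝ (G ν) p) (v) :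
    holoDeriv H p v = ∑ ν, (starRingEnd ℂ) (M p.1 ν σ) * holoDeriv (G ν) p v := by
  have h : H =ᶠ[nhds p] fun q => ∑ ν, (starRingEnd ℂ) (M q.1 ν σ) * G ν q :=
    Filter.eventually_of_mem (c.slit_mem_nhds hp) hH
  have hconj (ν) : DifferentiableAt ℝ
      (fun q : (Fin n → ℂ) × (Fin m → ℂ) => (starRingEnd ℂ) (M q.1 ν σ)) p :=
    conjCLE.differentiableAt.comp p ((c.diffAt_frame_fst hp ν σ).restrictScalars ℝ)
  rw [holoDeriv_congr h, holoDeriv_sum _ fun ν _ => (hconj ν).fun_mul (hG ν)]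
  refine Finset.sum_congr rfl fun ν _ => ?_
  rw [holoDeriv_mul (hconj ν) (hG ν), holoDeriv_conj (c.diffAt_frame_fst hp ν σ), zero_mul,
    zero_add]

theorem holoDeriv_wubar (c : FrameChange U Ut φ M W F Ft) (hp : p ∈ slit m U) (σ : Fin m) (v) :
    holoDeriv (wubar (fun q => (F q : ℂ)) σ) p v = ∑ ν, (starRingEnd ℂ) (M p.1 ν σ) *
      holoDeriv (wubar (fun q => (Ft q : ℂ)) ν) (bundleMap φ M p)
        (fderiv ℂ (bundleMap φ M) p v) := by
  have hd (ν) := c.diffAt_of_contDiffOn hp (c.contDiffOn_wubar ν)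
  rw [c.holoDeriv_sum_conj hp σ (fun q hq => c.wubar_eq hq σ)
    fun ν => (hd ν).comp p ((c.diffAt_bundleMap hp).restrictScalars ℝ)]
  exact Finset.sum_congr rfl fun ν _ => by
    rw [holoDeriv_comp (hd ν) (c.diffAt_bundleMap hp)]

theorem hmet_eq (c : FrameChange U Ut φ M W F Ft) (hp : p ∈ slit m U) (α σ : Fin m) :
    hmet F α σ p = ∑ ν, (starRingEnd ℂ) (M p.1 ν σ) *
      ∑ μ, M p.1 μ α * hmet Ft μ ν (bundleMap φ M p) := by
  rw [hmet, wu_eq, c.holoDeriv_wubar hp, c.fderiv_bundleMap hp]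
  simp only [map_zero, zero_mul, zero_add]
  simp only [holoDeriv_prod]
  simp [Pi.single_apply, hmet]

variable {hinv htinv : Fin m → Fin m → (Fin n → ℂ) × (Fin m → ℂ) → ℂ}

theorem inverse_metric (c : FrameChange U Ut φ M W F Ft) (hp : p ∈ slit m U)
    (hk : (Matrix.of fun α σ => hmet F α σ p) * (Matrix.of fun σ γ => hinv σ γ p) = 1)
    (hkt : (Matrix.of fun α σ => hmet Ft α σ (bundleMap φ M p)) *
      (Matrix.of fun σ γ => htinv σ γ (bundleMap φ M p)) = 1) :
    (Matrix.of fun ν σ => (starRingEnd ℂ) (M p.1 ν σ)) * (Matrix.of fun σ γ => hinv σ γ p) *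
      (Matrix.of (M p.1))ᵀ = Matrix.of fun σ γ => htinv σ γ (bundleMap φ M p) := by
  refine inverse_of_change_of_frame ?_ hk hkt
  ext α σ
  simp [c.hmet_eq hp, Matrix.mul_apply, mul_comm]

theorem fderiv_hlift (c : FrameChange U Ut φ M W F Ft) (hp : p ∈ slit m U)
    (hk : (Matrix.of fun α σ => hmet F α σ p) * (Matrix.of fun σ γ => hinv σ γ p) = 1)
    (hkt : (Matrix.of fun α σ => hmet Ft α σ (bundleMap φ M p)) *
      (Matrix.of fun σ γ => htinv σ γ (bundleMap φ M p)) = 1) (k : Fin n) :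
    fderiv ℂ (bundleMap φ M) p (hlift F hinv k p) =
      ∑ j, wz1 (fun z => φ z j) k p.1 • hlift Ft htinv j (bundleMap φ M p) := by
  set q := bundleMap φ M p with hq
  set a : Fin n → ℂ := fun j => fderiv ℂ (fun z => φ z j) p.1 (Pi.single k 1) with ha
  have haw (j) : wz1 (fun z => φ z j) k p.1 = a j := by
    rw [wz1_eq, holoDeriv_of_differentiableAt (c.diffAt_base hp j)]
  set C : Fin m → ℂ := fun ν => ∑ β, fderiv ℂ (fun z => M z ν β) p.1 (Pi.single k 1) * p.2 β
    with hC
  set Z : Fin m → ℂ := fun ν => ∑ j, a j * wz (wubar (fun q => (Ft q : ℂ)) ν) j q with hZ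
  have hX : (fun σ => wz (wubar (fun q => (F q : ℂ)) σ) k p) =
      (Z + C ᵥ* (Matrix.of fun α σ => hmet Ft α σ q)) ᵥ*
        (Matrix.of fun ν σ => (starRingEnd ℂ) (M p.1 ν σ)) := by
    ext σ
    rw [wz_eq, c.holoDeriv_wubar hp, c.fderiv_bundleMap hp]
    simp only [Pi.zero_apply, mul_zero, add_zero, holoDeriv_prod]
    simp only [Matrix.vecMul, dotProduct, Matrix.of_apply, Pi.add_apply, hZ, hC, ha, hmet, ← hq]
    exact Finset.sum_congr rfl fun ν _ => mul_comm _ _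
  have hN : (fun β => Ncf F hinv β k p) ᵥ* (Matrix.of (M p.1))ᵀ =
      Z ᵥ* (Matrix.of fun σ γ => htinv σ γ q) + C := by
    have h1 : (fun β => Ncf F hinv β k p) = (fun σ => wz (wubar (fun q => (F q : ℂ)) σ) k p) ᵥ*
        (Matrix.of fun σ γ => hinv σ γ p) := by
      ext β
      simp only [Ncf, Matrix.vecMul, dotProduct, Matrix.of_apply, mul_comm]
    rw [h1, hX, Matrix.vecMul_vecMul, Matrix.vecMul_vecMul, ← Matrix.mul_assoc, c.inverse_metric hp hk hkt,
      Matrix.add_vecMul, Matrix.vecMul_vecMul, hkt, Matrix.vecMul_one]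
  simp only [haw]
  rw [hlift, c.fderiv_bundleMap hp]
  ext i
  · simp [hlift, Prod.fst_sum, Pi.single_apply, ha]
  · have h2 := congrFun hN i
    simp only [Matrix.vecMul, dotProduct, Matrix.of_apply, Matrix.transpose_apply, Pi.add_apply,
      hZ, Finset.sum_mul] at h2
    rw [Finset.sum_comm] at h2
    simp only [hlift, Prod.snd_sum, Prod.smul_mk, Finset.sum_apply, Pi.smul_apply, smul_eq_mul,
      mul_neg, Finset.sum_neg_distrib, Finset.sum_add_distrib, Ncf, Finset.mul_sum]
    simp only [Ncf, mul_comm, mul_left_comm, Finset.mul_sum, hC] at h2 ⊢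
    rw [h2]
    ring

theorem deltak_hmet (c : FrameChange U Ut φ M W F Ft) (hp : p ∈ slit m U)
    (hk : (Matrix.of fun α σ => hmet F α σ p) * (Matrix.of fun σ γ => hinv σ γ p) = 1)
    (hkt : (Matrix.of fun α σ => hmet Ft α σ (bundleMap φ M p)) *
      (Matrix.of fun σ γ => htinv σ γ (bundleMap φ M p)) = 1) (k : Fin n) (α σ : Fin m) :
    deltak F hinv (hmet F α σ) k p = ∑ ν, (starRingEnd ℂ) (M p.1 ν σ) *
      ∑ μ, (wz1 (fun z => M z μ α) k p.1 * hmet Ft μ ν (bundleMap φ M p) +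
        M p.1 μ α * ∑ j, wz1 (fun z => φ z j) k p.1 *
          deltak Ft htinv (hmet Ft μ ν) j (bundleMap φ M p)) := by
  have hd (μ ν) := c.diffAt_of_contDiffOn hp (c.contDiffOn_hmet μ ν)
  have hd' (μ ν) : DifferentiableAt ℝ (fun q => hmet Ft μ ν (bundleMap φ M q)) p :=
    (hd μ ν).comp p ((c.diffAt_bundleMap hp).restrictScalars ℝ)
  have hMr (μ) := (c.diffAt_frame_fst hp μ α).restrictScalars ℝ
  rw [deltak_eq, c.holoDeriv_sum_conj hp σ (fun q hq => c.hmet_eq hq α σ)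
    fun ν => DifferentiableAt.fun_sum fun μ _ => (hMr μ).fun_mul (hd' μ ν)]
  refine Finset.sum_congr rfl fun ν _ => ?_
  rw [holoDeriv_sum _ fun μ _ => (hMr μ).fun_mul (hd' μ ν)]
  congr 1
  refine Finset.sum_congr rfl fun μ _ => ?_
  have hfst : fderiv ℂ (fun q : (Fin n → ℂ) × (Fin m → ℂ) => q.1) p (hlift F hinv k p) =
      Pi.single k 1 := by
    rw [fderiv_fst]; rfl
  rw [holoDeriv_mul (hMr μ) (hd' μ ν), holoDeriv_comp (hd μ ν) (c.diffAt_bundleMap hp),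
    c.fderiv_hlift hp hk hkt, map_sum,
    holoDeriv_comp (g := fun z => M z μ α) (f := fun q : (Fin n → ℂ) × (Fin m → ℂ) => q.1)
      ((c.diffAt_frame hp μ α).restrictScalars ℝ) differentiableAt_fst, hfst, ← wz1_eq]
  simp only [map_smul, smul_eq_mul, ← deltak_eq]

theorem diffAt_inverse (c : FrameChange U Ut φ M W F Ft) {z} (hz : z ∈ U) (α β : Fin m) :
    DifferentiableAt ℂ (fun z => W z α β) z := by
  have hM (i j) := (c.diff_frame i j).differentiableAt (c.isOpen.mem_nhds hz)
  have hdet : IsUnit (Matrix.of (M z)).det :=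
    Matrix.isUnit_det_of_right_inverse (c.mul_inverse z hz)
  have h : (fun z => W z α β) =ᶠ[nhds z]
      fun z => (Matrix.of (M z)).det⁻¹ * (Matrix.of (M z)).adjugate α β := by
    filter_upwards [c.isOpen.mem_nhds hz] with w hw
    have hW : Matrix.of (W w) = (Matrix.of (M w))⁻¹ :=
      (Matrix.inv_eq_right_inv (c.mul_inverse w hw)).symm
    calc W w α β = Matrix.of (W w) α β := rfl
      _ = _ := by rw [hW, Matrix.inv_def, Ring.inverse_eq_inv']; rfl
  refine DifferentiableAt.congr_of_eventuallyEq ?_ h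
  refine DifferentiableAt.mul (DifferentiableAt.inv (differentiableAt_det hM) hdet.ne_zero) ?_
  simp only [Matrix.adjugate_apply]
  refine differentiableAt_det fun i j => ?_
  by_cases hi : i = β
  · subst hi; simp
  · simpa [Matrix.updateRow_ne hi] using hM i j

theorem wz1_mul_inverse (c : FrameChange U Ut φ M W F Ft) {z} (hz : z ∈ U) (k : Fin n) :
    (Matrix.of fun α β => wz1 (fun z => M z α β) k z) * Matrix.of (W z) +
      Matrix.of (M z) * (Matrix.of fun α β => wz1 (fun z => W z α β) k z) = 0 := by
  ext α γ
  have hM (i j) := ((c.diff_frame i j).differentiableAt (c.isOpen.mem_nhds hz)).restrictScalars ℝ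
  have hW (i j) := (c.diffAt_inverse hz i j).restrictScalars ℝ
  have h : (fun z => ∑ β, M z α β * W z β γ) =ᶠ[nhds z]
      fun _ => (1 : Matrix (Fin m) (Fin m) ℂ) α γ := by
    filter_upwards [c.isOpen.mem_nhds hz] with w hw
    rw [← c.mul_inverse w hw, Matrix.mul_apply]
    rfl
  have h2 := congrArg (fun L => L (Pi.single k 1)) (holoDeriv_congr h)
  simp only [holoDeriv_sum _ fun β _ => (hM α β).fun_mul (hW β γ),
    holoDeriv_of_differentiableAt (differentiableAt_const _)] at h2
  simpa [holoDeriv_mul (hM _ _) (hW _ _), ← wz1_eq, Finset.sum_add_distrib,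
    Matrix.mul_apply] using h2

theorem anchored_coefficients (c : FrameChange U Ut φ M W F Ft) (hp : p ∈ slit m U)
    (hk : (Matrix.of fun α σ => hmet F α σ p) * (Matrix.of fun σ γ => hinv σ γ p) = 1)
    (hkt : (Matrix.of fun α σ => hmet Ft α σ (bundleMap φ M p)) *
      (Matrix.of fun σ γ => htinv σ γ (bundleMap φ M p)) = 1) (k : Fin n) :
    (Matrix.of fun α σ => ∑ j, wz1 (fun z => φ z j) k p.1 *
        deltak Ft htinv (hmet Ft α σ) j (bundleMap φ M p)) *
      (Matrix.of fun σ γ => htinv σ γ (bundleMap φ M p)) =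
    ((Matrix.of (W p.1))ᵀ * ((Matrix.of fun α σ => deltak F hinv (hmet F α σ) k p) *
        (Matrix.of fun σ γ => hinv σ γ p)) +
      (Matrix.of fun α β => wz1 (fun z => W z α β) k p.1)ᵀ) * (Matrix.of (M p.1))ᵀ := by
  set Dt : Matrix (Fin m) (Fin m) ℂ := Matrix.of fun α σ => ∑ j, wz1 (fun z => φ z j) k p.1 *
        deltak Ft htinv (hmet Ft α σ) j (bundleMap φ M p) with hDt
  have hD : (Matrix.of fun α σ => deltak F hinv (hmet F α σ) k p) =
      ((Matrix.of fun α β => wz1 (fun z => M z α β) k p.1)ᵀ *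
          (Matrix.of fun α σ => hmet Ft α σ (bundleMap φ M p)) + (Matrix.of (M p.1))ᵀ * Dt) *
        (Matrix.of fun ν σ => (starRingEnd ℂ) (M p.1 ν σ)) := by
    ext α σ
    simp only [Matrix.of_apply, c.deltak_hmet hp hk hkt, Matrix.mul_apply, Matrix.add_apply,
      Matrix.transpose_apply, hDt, Finset.sum_add_distrib]
    exact Finset.sum_congr rfl fun ν _ => mul_comm _ _
  have hWM : (Matrix.of (W p.1))ᵀ * (Matrix.of (M p.1))ᵀ = 1 := by
    rw [← Matrix.transpose_mul, c.mul_inverse p.1 hp.1, Matrix.transpose_one]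
  have hdW := congrArg Matrix.transpose (c.wz1_mul_inverse hp.1 k)
  rw [Matrix.transpose_add, Matrix.transpose_mul, Matrix.transpose_mul,
    Matrix.transpose_zero] at hdW
  rw [hD, Matrix.add_mul, Matrix.mul_assoc, Matrix.mul_assoc, Matrix.mul_assoc,
    ← Matrix.mul_assoc (Matrix.of fun ν σ => (starRingEnd ℂ) (M p.1 ν σ)),
    c.inverse_metric hp hk hkt, Matrix.add_mul, Matrix.mul_assoc, hkt, Matrix.mul_add,
    Matrix.mul_one, Matrix.mul_assoc, ← Matrix.mul_assoc _ _ (Dt * _), hWM, Matrix.one_mul,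
    add_right_comm, hdW, zero_add]

end FrameChange

theorem Lcf_eq (F : (Fin n → ℂ) × (Fin m → ℂ) → ℝ)
    (hinv : Fin m → Fin m → (Fin n → ℂ) × (Fin m → ℂ) → ℂ)
    (ρ : Fin n → Fin m → (Fin n → ℂ) → ℂ) (γ α β : Fin m) (p) :
    Lcf F hinv ρ γ α β p = ∑ k, ρ k β p.1 *
      ((Matrix.of fun α σ => deltak F hinv (hmet F α σ) k p) *
        (Matrix.of fun σ γ => hinv σ γ p)) α γ := by
  simp only [Lcf, delanch, Matrix.mul_apply, Matrix.of_apply, Finset.mul_sum]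
  rw [Finset.sum_comm]
  exact Finset.sum_congr rfl fun _ _ => Finset.sum_congr rfl fun _ _ => by ring

end ChangeOfFrame

/-- transformation law of the Chern–Finsler connection coefficients
`L^γ_{αβ} = h^{σ̄γ}·δ_β h_{ασ̄}` under a change of local chart `(φ, M)`:
`L̃^τ_{αβ}(φ(z), M(z)u) = M^τ_γ(z)·W^σ_β(z)·[ρ^k_σ(z)·(∂W^γ_α/∂z^k)(z) + W^θ_α(z)·L^γ_{θσ}(z,u)]`,
showing that they are the coefficients of a linear connection of (1,0)-type on the
complexified prolongation (the Chern–Finsler connection of the algebroid). -/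
theorem stmt13 {n m : ℕ} (U Ut : Set (Fin n → ℂ)) (hU : IsOpen U) (hUt : IsOpen Ut)
    -- the biholomorphism φ : U → Ũ with inverse ψ
    (φ ψ : (Fin n → ℂ) → (Fin n → ℂ))
    (hφ : ∀ k : Fin n, DifferentiableOn ℂ (fun z => φ z k) U)
    (hψ : ∀ k : Fin n, DifferentiableOn ℂ (fun w => ψ w k) Ut)
    (hφm : Set.MapsTo φ U Ut) (hψm : Set.MapsTo ψ Ut U)
    (hψφ : ∀ z ∈ U, ψ (φ z) = z) (hφψ : ∀ w ∈ Ut, φ (ψ w) = w)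
    -- the holomorphic matrix of change M with pointwise inverse W
    (M W : (Fin n → ℂ) → Fin m → Fin m → ℂ)
    (hM : ∀ α β : Fin m, DifferentiableOn ℂ (fun z => M z α β) U)
    (hMW : ∀ z ∈ U, ∀ α γ : Fin m,
      (∑ β, M z α β * W z β γ = if α = γ then 1 else 0)
      ∧ (∑ β, W z α β * M z β γ = if α = γ then 1 else 0))
    -- anchor coefficients and their transformation law
    (ρ ρt : Fin n → Fin m → (Fin n → ℂ) → ℂ)
    (hρ : ∀ (k : Fin n) (α : Fin m), DifferentiableOn ℂ (ρ k α) U)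
    (hρt : ∀ (k : Fin n) (α : Fin m), DifferentiableOn ℂ (ρt k α) Ut)
    (hρrel : ∀ z ∈ U, ∀ (k : Fin n) (α : Fin m),
      ρt k α (φ z) = ∑ β, ∑ h, W z β α * ρ h β z * wz1 (fun w => φ w k) h z)
    -- the Finsler function and its Levi metric on the initial chart
    (F : (Fin n → ℂ) × (Fin m → ℂ) → ℝ)
    (hF : ContDiffOn ℝ (⊤ : ℕ∞) F {p : (Fin n → ℂ) × (Fin m → ℂ) | p.1 ∈ U ∧ p.2 ≠ 0})
    (hinv : Fin m → Fin m → (Fin n → ℂ) × (Fin m → ℂ) → ℂ)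
    (hinv_spec : ∀ p ∈ {p : (Fin n → ℂ) × (Fin m → ℂ) | p.1 ∈ U ∧ p.2 ≠ 0},
      ∀ α γ : Fin m, ∑ β, hmet F α β p * hinv β γ p = if α = γ then 1 else 0)
    -- the transformed Finsler function and its Levi metric
    (Ft : (Fin n → ℂ) × (Fin m → ℂ) → ℝ)
    (hFt : ContDiffOn ℝ (⊤ : ℕ∞) Ft {p : (Fin n → ℂ) × (Fin m → ℂ) | p.1 ∈ Ut ∧ p.2 ≠ 0})
    (htinv : Fin m → Fin m → (Fin n → ℂ) × (Fin m → ℂ) → ℂ)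
    (htinv_spec : ∀ p ∈ {p : (Fin n → ℂ) × (Fin m → ℂ) | p.1 ∈ Ut ∧ p.2 ≠ 0},
      ∀ α γ : Fin m, ∑ β, hmet Ft α β p * htinv β γ p = if α = γ then 1 else 0)
    (hFrel : ∀ z ∈ U, ∀ u : Fin m → ℂ, u ≠ 0 →
      Ft (φ z, fun δ => ∑ β, M z δ β * u β) = F (z, u)) :
    ∀ z ∈ U, ∀ u : Fin m → ℂ, u ≠ 0 → ∀ α β τ : Fin m,
      Lcf Ft htinv ρt τ α β (φ z, fun δ => ∑ ε, M z δ ε * u ε)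
        = ∑ γ, ∑ σ, M z τ γ * W z σ β *
            ((∑ k, ρ k σ z * wz1 (fun w => W w γ α) k z)
              + ∑ θ, W z θ α * Lcf F hinv ρ γ θ σ (z, u)) := by
  intro z hz u hu α β τ
  have c : FrameChange U Ut φ M W F Ft :=
    { isOpen := hU
      isOpen_target := hUt
      diff_base := hφ
      mapsTo := hφm
      diff_frame := hM
      mul_inverse := fun z hz => by
        ext α γ
        rw [Matrix.mul_apply, Matrix.one_apply]
        exact (hMW z hz α γ).1
      smooth := hFt
      rel := fun p hp => hFrel p.1 hp.1 p.2 hp.2 }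
  have hp : (z, u) ∈ slit m U := ⟨hz, hu⟩
  have hk : (Matrix.of fun α σ => hmet F α σ (z, u)) *
      (Matrix.of fun σ γ => hinv σ γ (z, u)) = 1 := by
    ext α γ
    rw [Matrix.mul_apply, Matrix.one_apply]
    exact hinv_spec _ hp α γ
  have hkt : (Matrix.of fun α σ => hmet Ft α σ (bundleMap φ M (z, u))) *
      (Matrix.of fun σ γ => htinv σ γ (bundleMap φ M (z, u))) = 1 := by
    ext α γ
    rw [Matrix.mul_apply, Matrix.one_apply]
    exact htinv_spec _ (c.bundleMap_mem hp) α γ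
  have key (k : Fin n) := congrFun (congrFun (c.anchored_coefficients hp hk hkt k) α) τ
  change Lcf Ft htinv ρt τ α β (bundleMap φ M (z, u)) = _
  calc Lcf Ft htinv ρt τ α β (bundleMap φ M (z, u))
      = ∑ σ, ∑ k, W z σ β * ρ k σ z *
          ((Matrix.of fun α σ => ∑ j, wz1 (fun z => φ z j) k z *
              deltak Ft htinv (hmet Ft α σ) j (bundleMap φ M (z, u))) *
            (Matrix.of fun σ γ => htinv σ γ (bundleMap φ M (z, u)))) α τ := by
        have hT (k : Fin n) : ((Matrix.of fun α σ => ∑ j, wz1 (fun z => φ z j) k z *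
              deltak Ft htinv (hmet Ft α σ) j (bundleMap φ M (z, u))) *
            (Matrix.of fun σ γ => htinv σ γ (bundleMap φ M (z, u)))) α τ =
            ∑ j, wz1 (fun z => φ z j) k z *
              ((Matrix.of fun α σ => deltak Ft htinv (hmet Ft α σ) j (bundleMap φ M (z, u))) *
                (Matrix.of fun σ γ => htinv σ γ (bundleMap φ M (z, u)))) α τ := by
          simp only [Matrix.mul_apply, Matrix.of_apply, Finset.sum_mul, Finset.mul_sum, mul_assoc]
          exact Finset.sum_comm
        have hρ' (j : Fin n) : ρt j β (bundleMap φ M (z, u)).1 = _ := hρrel z hz j β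
        simp only [Lcf_eq, hT, hρ', Finset.sum_mul, Finset.mul_sum, mul_assoc]
        rw [Finset.sum_comm]
        exact Finset.sum_congr rfl fun _ _ => Finset.sum_comm
    _ = ∑ σ, ∑ k, ∑ γ, M z τ γ * W z σ β * (ρ k σ z * wz1 (fun w => W w γ α) k z +
          ∑ θ, W z θ α * (ρ k σ z * ((Matrix.of fun α σ => deltak F hinv (hmet F α σ) k (z, u)) *
            (Matrix.of fun σ γ => hinv σ γ (z, u))) θ γ)) := by
        refine Finset.sum_congr rfl fun σ _ => Finset.sum_congr rfl fun k _ => ?_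
        rw [key, Matrix.mul_apply, Finset.mul_sum]
        refine Finset.sum_congr rfl fun γ _ => ?_
        rw [Matrix.add_apply, Matrix.mul_apply]
        simp only [Matrix.transpose_apply, Matrix.of_apply, mul_left_comm (W z _ α),
          ← Finset.mul_sum]
        ring
    _ = _ := by
        simp only [Lcf_eq]
        rw [Finset.sum_comm (s := Finset.univ (α := Fin m)) (t := Finset.univ (α := Fin m))]
        refine Finset.sum_congr rfl fun σ _ => ?_
        rw [Finset.sum_comm]
        refine Finset.sum_congr rfl fun γ _ => ?_
        rw [← Finset.mul_sum, Finset.sum_add_distrib, Finset.sum_comm]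
        simp only [← Finset.mul_sum]
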